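/- arXiv:1910.08391 — 3 statements merged into one kernel-verified Lean document; each statement's English description precedes it below -/
import Mathlib

section
/- Let σ : (0,1] → ℝ be such that h(η) := σ(η)/η extends to a continuous function on [0,1] with ∫₀¹ h(η) dη = π. Then S_N^σ[r₀](0) = (1/π) Σ_{k=1}^{N} σ(k/N)/k converges to 1 = [r₀](0) as N → ∞. -/
open Real Filter

/-- The Fourier coefficients of the ramp function: `r̂₀_k = 1/(2πik)` for `k ≠ 0`, `0` else. -/
noncomputable def rampCoef : ℤ → ℂ := fun k =>
  if k = 0 then 0 else 1 / (2 * (π : ℂ) * Complex.I * k)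

/-- The concentration factor sum built from given Fourier coefficients `c`:
`i Σ_{0<|k|≤N} c_k sgn(k) σ(|k|/N) e^{ikx}`. -/
noncomputable def concSumC (σ : ℝ → ℝ) (N : ℕ) (c : ℤ → ℂ) (x : ℝ) : ℂ :=
  Complex.I * ∑ k ∈ Finset.Icc (-(N : ℤ)) (N : ℤ) \ {0},
    c k * (Int.sign k : ℂ) * (σ (|(k : ℝ)| / N) : ℂ) * Complex.exp (Complex.I * k * x)

/-- A sum over the nonzero integers of absolute value at most `N` pairs `k` with `-k`. -/
theorem sum_Icc_neg_sdiff_zero {M : Type*} [AddCommMonoid M] (f : ℤ → M) (N : ℕ) :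
    ∑ k ∈ Finset.Icc (-(N : ℤ)) (N : ℤ) \ {0}, f k
      = ∑ k ∈ Finset.Icc 1 N, (f (k : ℤ) + f (-(k : ℤ))) := by
  induction N with
  | zero => simp
  | succ n ih =>
    have hset : Finset.Icc (-((n + 1 : ℕ) : ℤ)) ((n + 1 : ℕ) : ℤ) \ {0}
        = insert ((n + 1 : ℕ) : ℤ) (insert (-((n + 1 : ℕ) : ℤ))
          (Finset.Icc (-(n : ℤ)) (n : ℤ) \ {0})) := by
      ext k
      simp only [Finset.mem_sdiff, Finset.mem_Icc, Finset.mem_singleton, Finset.mem_insert]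
      omega
    rw [hset, Finset.sum_insert, Finset.sum_insert, ih, Finset.sum_Icc_succ_top (by omega)]
    · rw [← add_assoc, add_comm]
    · simp only [Finset.mem_sdiff, Finset.mem_Icc, Finset.mem_singleton]
      omega
    · simp only [Finset.mem_sdiff, Finset.mem_Icc, Finset.mem_singleton, Finset.mem_insert]
      omega

/-- The concentration factor sum of the ramp function at its jump. -/
theorem concSumC_rampCoef_zero (σ : ℝ → ℝ) (N : ℕ) :
    concSumC σ N rampCoef 0
      = (((1 / π) * ∑ k ∈ Finset.Icc 1 N, σ ((k : ℝ) / N) / k : ℝ) : ℂ) := by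
  unfold concSumC
  rw [sum_Icc_neg_sdiff_zero]
  push_cast
  rw [Finset.mul_sum, Finset.mul_sum]
  refine Finset.sum_congr rfl fun k hk => ?_
  have hk1 : 1 ≤ k := (Finset.mem_Icc.mp hk).1
  have hk0 : (k : ℤ) ≠ 0 := by omega
  have hkC : (k : ℂ) ≠ 0 := by exact_mod_cast hk0
  have hπ : (π : ℂ) ≠ 0 := by exact_mod_cast pi_ne_zero
  have hs : Int.sign (k : ℤ) = 1 := Int.sign_eq_one_of_pos (by omega)
  simp only [rampCoef, neg_eq_zero, hk0, if_false, Int.sign_neg, hs, Int.cast_neg,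
    Int.cast_natCast, abs_neg, Nat.abs_cast, Int.cast_one, mul_zero,
    Complex.exp_zero]
  field_simp
  ring

/-- Right-endpoint Riemann sums of a continuous function on `[0,1]` converge to its integral. -/
theorem tendsto_sum_right_endpoint_integral {h : ℝ → ℝ} (hcont : ContinuousOn h (Set.Icc 0 1)) :
    Tendsto (fun N : ℕ => ∑ k ∈ Finset.range N, h (((k + 1 : ℕ) : ℝ) / N) / N) atTop
      (nhds (∫ η in (0 : ℝ)..1, h η)) := by
  have huc := isCompact_Icc.uniformContinuousOn_of_continuous hcont
  rw [Metric.uniformContinuousOn_iff_le] at huc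
  refine Metric.tendsto_atTop.mpr fun ε hε => ?_
  obtain ⟨δ, hδ, hclose⟩ := huc (ε / 2) (half_pos hε)
  obtain ⟨N₀, hN₀⟩ := exists_nat_one_div_lt hδ
  refine ⟨N₀ + 1, fun N hN => ?_⟩
  have hNpos : (0 : ℝ) < N := by exact_mod_cast (by omega : 0 < N)
  have hmesh : 1 / (N : ℝ) ≤ δ := by
    refine le_trans (one_div_le_one_div_of_le (by positivity) ?_) hN₀.le
    exact_mod_cast hN
  have hstep (k : ℕ) : (k : ℝ) / N ≤ ((k + 1 : ℕ) : ℝ) / N := by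
    gcongr
    omega
  have hsub {k : ℕ} (hk : k < N) :
      Set.Icc ((k : ℝ) / N) (((k + 1 : ℕ) : ℝ) / N) ⊆ Set.Icc 0 1 := by
    refine Set.Icc_subset_Icc (by positivity) ?_
    rw [div_le_one hNpos]
    exact_mod_cast hk
  have hii {k : ℕ} (hk : k < N) :
      IntervalIntegrable h MeasureTheory.volume ((k : ℝ) / N) (((k + 1 : ℕ) : ℝ) / N) :=
    (hcont.mono (hsub hk)).intervalIntegrable_of_Icc (hstep k)
  have hsplit := intervalIntegral.sum_integral_adjacent_intervals
    (a := fun k : ℕ => (k : ℝ) / N) (fun k hk => hii hk)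
  simp only [Nat.cast_zero, zero_div, div_self hNpos.ne'] at hsplit
  have hterm {k : ℕ} (hk : k < N) :
      |h (((k + 1 : ℕ) : ℝ) / N) / N - ∫ η in ((k : ℝ) / N)..(((k + 1 : ℕ) : ℝ) / N), h η|
        ≤ ε / 2 * (1 / N) := by
    have hlen : ((k + 1 : ℕ) : ℝ) / N - (k : ℝ) / N = 1 / N := by
      push_cast
      ring
    have hconst : h (((k + 1 : ℕ) : ℝ) / N) / N
        = ∫ _ in ((k : ℝ) / N)..(((k + 1 : ℕ) : ℝ) / N), h (((k + 1 : ℕ) : ℝ) / N) := by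
      rw [intervalIntegral.integral_const, hlen, smul_eq_mul]
      ring
    rw [hconst, ← intervalIntegral.integral_sub intervalIntegrable_const (hii hk),
      ← Real.norm_eq_abs]
    refine (intervalIntegral.norm_integral_le_of_norm_le_const (C := ε / 2)
      fun x hx => ?_).trans_eq ?_
    · rw [Set.uIoc_of_le (hstep k)] at hx
      refine hclose _ (hsub hk (Set.right_mem_Icc.mpr (hstep k))) _
        (hsub hk (Set.Ioc_subset_Icc_self hx)) ?_
      rw [Real.dist_eq, abs_of_nonneg (sub_nonneg.mpr hx.2)]
      linarith [hx.1]
    · rw [hlen, abs_of_pos (by positivity)]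
  rw [Real.dist_eq, ← hsplit, ← Finset.sum_sub_distrib]
  calc |∑ k ∈ Finset.range N, (h (((k + 1 : ℕ) : ℝ) / N) / N
          - ∫ η in ((k : ℝ) / N)..(((k + 1 : ℕ) : ℝ) / N), h η)|
      ≤ ∑ k ∈ Finset.range N, |h (((k + 1 : ℕ) : ℝ) / N) / N
          - ∫ η in ((k : ℝ) / N)..(((k + 1 : ℕ) : ℝ) / N), h η| := Finset.abs_sum_le_sum_abs _ _
    _ ≤ ∑ _k ∈ Finset.range N, ε / 2 * (1 / N) :=
        Finset.sum_le_sum fun k hk => hterm (Finset.mem_range.mp hk)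
    _ = ε / 2 := by
        rw [Finset.sum_const, Finset.card_range, nsmul_eq_mul]
        field_simp
    _ < ε := half_lt_self hε

/-- If `h(η) := σ(η)/η` extends continuously to `[0,1]` with `∫₀¹ h = π`, then
`S_N^σ[r₀](0) = (1/π) Σ_{k=1}^N σ(k/N)/k` converges to `1 = [r₀](0)` as `N → ∞`. -/
theorem concSum_ramp_at_jump_tendsto_one (σ h : ℝ → ℝ)
    (hcont : ContinuousOn h (Set.Icc 0 1))
    (hext : ∀ η ∈ Set.Ioc (0 : ℝ) 1, h η = σ η / η)
    (hint : ∫ η in (0 : ℝ)..1, h η = π) :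
    (∀ N : ℕ, 1 ≤ N → concSumC σ N rampCoef 0
        = (((1 / π) * ∑ k ∈ Finset.Icc 1 N, σ ((k : ℝ) / N) / k : ℝ) : ℂ)) ∧
    Tendsto (fun N : ℕ => (1 / π) * ∑ k ∈ Finset.Icc 1 N, σ ((k : ℝ) / N) / k)
      atTop (nhds 1) := by
  refine ⟨fun N _ => concSumC_rampCoef_zero σ N, ?_⟩
  have hlim := (tendsto_sum_right_endpoint_integral hcont).const_mul (1 / π)
  rw [hint, one_div_mul_cancel pi_ne_zero] at hlim
  refine hlim.congr fun N => ?_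
  rw [Finset.range_eq_Ico, Finset.sum_Ico_add' (fun k : ℕ => h ((k : ℝ) / N) / N) 0 N 1, zero_add,
    Finset.Ico_add_one_right_eq_Icc]
  refine congrArg _ (Finset.sum_congr rfl fun k hk => ?_)
  obtain ⟨hk1, hkN⟩ := Finset.mem_Icc.mp hk
  have hkpos : (0 : ℝ) < k := by exact_mod_cast hk1
  have hNpos : (0 : ℝ) < N := by exact_mod_cast hk1.trans hkN
  rw [hext _ ⟨by positivity, (div_le_one hNpos).mpr (by exact_mod_cast hkN)⟩]
  field_simp
end

section
/- Let σ : (0,1] → ℝ be such that h(η) := σ(η)/η extends to a continuously differentiable function on [0,1]. Then for every fixed x ∈ (0,2π), the quantity W₀^σ(x) = (1/π) Σ_{k=1}^{N} (σ(k/N)/k) cos(kx) converges to 0 as N → ∞. -/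
open Real Filter

/-- Summation by parts bound: if `|s| ≤ 1` and consecutive values of `a` differ by at most `δ`,
then `∑ a (k + 1) * (s (k + 1) - s k)` differs from its boundary terms by at most `n * δ`. -/
lemma abs_sum_mul_sub_sub_boundary_le {a s : ℕ → ℝ} {δ : ℝ} (n : ℕ)
    (hs : ∀ k, |s k| ≤ 1) (ha : ∀ k < n, |a k - a (k + 1)| ≤ δ) :
    |∑ k ∈ Finset.range n, a (k + 1) * (s (k + 1) - s k) - (a n * s n - a 0 * s 0)| ≤ n * δ := by
  induction n with
  | zero => simp
  | succ n ih =>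
    have h1 := ih fun k hk => ha k (by omega)
    have h2 : |(a n - a (n + 1)) * s n| ≤ δ := by
      rw [abs_mul]
      exact (mul_le_of_le_one_right (abs_nonneg _) (hs n)).trans (ha n (by omega))
    rw [Finset.sum_range_succ]
    calc _ = |(∑ k ∈ Finset.range n, a (k + 1) * (s (k + 1) - s k) - (a n * s n - a 0 * s 0))
            + (a n - a (n + 1)) * s n| := by congr 1; ring
      _ ≤ n * δ + δ := (abs_add_le _ _).trans (add_le_add h1 h2)
      _ = _ := by push_cast; ring

/-- For `h` Lipschitz on `[0,1]`, the sums `∑ h(k/N) cos(kx)` are bounded uniformly in `N`,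
up to the factor `2 sin(x/2)`. -/
lemma abs_sin_mul_sum_lipschitz_mul_cos_le {h : ℝ → ℝ} {K : NNReal}
    (hK : LipschitzOnWith K h (Set.Icc 0 1)) (x : ℝ) {N : ℕ} (hN : 0 < N) :
    |2 * sin (x / 2) * ∑ k ∈ Finset.Icc 1 N, h ((k : ℝ) / N) * cos (k * x)| ≤
      K + |h 1| + |h 0| := by
  have hN' : (0 : ℝ) < N := by exact_mod_cast hN
  set a : ℕ → ℝ := fun k => h ((k : ℝ) / N)
  set s : ℕ → ℝ := fun k => sin (((k : ℝ) + 1 / 2) * x)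
  have hs : ∀ k, |s k| ≤ 1 := fun k => abs_sin_le_one _
  have ha : ∀ k < N, |a k - a (k + 1)| ≤ K * (1 / N) := by
    intro k hk
    have hk' : (k : ℝ) + 1 ≤ N := by exact_mod_cast hk
    have h1 : (k : ℝ) / N ∈ Set.Icc (0 : ℝ) 1 :=
      ⟨by positivity, (div_le_one hN').2 (by linarith)⟩
    have h2 : ((k + 1 : ℕ) : ℝ) / N ∈ Set.Icc (0 : ℝ) 1 :=
      ⟨by positivity, (div_le_one hN').2 (by push_cast; exact hk')⟩
    have h3 := hK.dist_le_mul _ h1 _ h2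
    rw [Real.dist_eq, Real.dist_eq] at h3
    have h4 : (k : ℝ) / N - ((k + 1 : ℕ) : ℝ) / N = -(1 / N) := by push_cast; ring
    rwa [h4, abs_neg, abs_of_pos (by positivity : (0 : ℝ) < 1 / N)] at h3
  have hsum : 2 * sin (x / 2) * ∑ k ∈ Finset.Icc 1 N, h ((k : ℝ) / N) * cos (k * x) =
      ∑ k ∈ Finset.range N, a (k + 1) * (s (k + 1) - s k) := by
    have hshift := Finset.sum_Ico_add' (fun k => a k * (s k - s (k - 1))) 0 N 1
    simp only [Nat.add_sub_cancel] at hshift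
    rw [Finset.range_eq_Ico, hshift, Finset.mul_sum]
    refine Finset.sum_congr (by ext; simp) fun k hk => ?_
    obtain ⟨j, rfl⟩ : ∃ j, k = j + 1 := ⟨k - 1, by simp at hk; omega⟩
    simp only [a, s, Nat.add_sub_cancel]
    rw [sin_sub_sin]
    push_cast
    ring_nf
  have hb := abs_sum_mul_sub_sub_boundary_le N hs ha
  have haN : a N = h 1 := by simp [a, hN'.ne']
  have ha0 : a 0 = h 0 := by simp [a]
  have e : (N : ℝ) * (K * (1 / N)) = K := by field_simp
  rw [haN, ha0, e] at hb
  have b1 : |h 1 * s N| ≤ |h 1| := by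
    rw [abs_mul]; exact mul_le_of_le_one_right (abs_nonneg _) (hs N)
  have b0 : |h 0 * s 0| ≤ |h 0| := by
    rw [abs_mul]; exact mul_le_of_le_one_right (abs_nonneg _) (hs 0)
  rw [hsum]
  rw [abs_le] at *
  constructor <;> linarith

/-- If `h(η) := σ(η)/η` extends to a continuously differentiable function on
`[0,1]`, then for every fixed `x ∈ (0, 2π)`,
`W₀^σ(x) = (1/π) Σ_{k=1}^N (σ(k/N)/k) cos(kx)` converges to `0` as `N → ∞`. -/
theorem W0_tendsto_zero_away_from_jump (σ h : ℝ → ℝ)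
    (hC1 : ContDiffOn ℝ 1 h (Set.Icc 0 1))
    (hext : ∀ η ∈ Set.Ioc (0 : ℝ) 1, h η = σ η / η)
    (x : ℝ) (hx : x ∈ Set.Ioo 0 (2 * π)) :
    Tendsto (fun N : ℕ => (1 / π) * ∑ k ∈ Finset.Icc 1 N, σ ((k : ℝ) / N) / k * Real.cos ((k : ℝ) * x))
      atTop (nhds 0) := by
  obtain ⟨K, hK⟩ := hC1.exists_lipschitzOnWith one_ne_zero (convex_Icc 0 1) isCompact_Icc
  have hsin : 0 < sin (x / 2) :=
    sin_pos_of_pos_of_lt_pi (by linarith [hx.1]) (by linarith [hx.2])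
  set C : ℝ := 1 / π * ((K + |h 1| + |h 0|) / (2 * sin (x / 2)))
  refine squeeze_zero_norm' ?_ (tendsto_const_div_atTop_nhds_zero_nat C)
  filter_upwards [eventually_gt_atTop 0] with N hN
  have hN' : (0 : ℝ) < N := by exact_mod_cast hN
  have hsum : ∑ k ∈ Finset.Icc 1 N, σ ((k : ℝ) / N) / k * cos (k * x) =
      (∑ k ∈ Finset.Icc 1 N, h ((k : ℝ) / N) * cos (k * x)) / N := by
    rw [Finset.sum_div]
    refine Finset.sum_congr rfl fun k hk => ?_
    obtain ⟨hk1, hkN⟩ := Finset.mem_Icc.1 hk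
    have hk1' : (0 : ℝ) < k := by exact_mod_cast hk1
    have hkN' : (k : ℝ) ≤ N := by exact_mod_cast hkN
    rw [hext _ ⟨by positivity, (div_le_one hN').2 hkN'⟩]
    field_simp
  have hb := abs_sin_mul_sum_lipschitz_mul_cos_le hK x hN
  rw [abs_mul, abs_of_pos (by positivity : 0 < 2 * sin (x / 2)), mul_comm,
    ← le_div_iff₀ (by positivity)] at hb
  rw [hsum, Real.norm_eq_abs, abs_mul, abs_of_pos (by positivity : 0 < 1 / π), abs_div,
    abs_of_pos hN', ← mul_div_assoc]
  gcongr
  exact mul_le_mul_of_nonneg_left hb (by positivity)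
end

section
/- Let g : ℝ → ℝ be 2π-periodic and twice continuously differentiable, and let σ : [0,1] → ℝ be Lipschitz with σ(0) = 0. Then sup_{x∈ℝ} |S_N^σ[g](x)| → 0 as N → ∞; that is, the concentration factor sum of a smooth (jump-free) function vanishes uniformly in the limit. -/
open Real MeasureTheory Filter

/-- The k-th Fourier coefficient `ĝ_k = (1/(2π)) ∫_{-π}^{π} g(x) e^{-ikx} dx`. -/
noncomputable def fourierCoef (f : ℝ → ℂ) (k : ℤ) : ℂ :=
  (1 / (2 * (π : ℂ))) * ∫ x in (-π)..π, f x * Complex.exp (-Complex.I * k * x)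

/-- The concentration factor sum `S_N^σ[g](x) = i Σ_{0<|k|≤N} ĝ_k sgn(k) σ(|k|/N) e^{ikx}`. -/
noncomputable def concSum (σ : ℝ → ℝ) (N : ℕ) (f : ℝ → ℂ) (x : ℝ) : ℂ :=
  Complex.I * ∑ k ∈ Finset.Icc (-(N : ℤ)) (N : ℤ) \ {0},
    fourierCoef f k * (Int.sign k : ℂ) * (σ (|(k : ℝ)| / N) : ℂ) * Complex.exp (Complex.I * k * x)

theorem norm_exp_I_mul_int_mul_ofReal (k : ℤ) (x : ℝ) :
    ‖Complex.exp (Complex.I * k * x)‖ = 1 := by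
  simp [Complex.norm_exp]

theorem norm_exp_neg_I_mul_int_mul_ofReal (k : ℤ) (x : ℝ) :
    ‖Complex.exp (-Complex.I * k * x)‖ = 1 := by
  simp [Complex.norm_exp]

theorem exp_neg_I_mul_int_mul_pi (k : ℤ) :
    Complex.exp (-Complex.I * k * (π : ℝ)) = Complex.exp (-Complex.I * k * ((-π : ℝ) : ℂ)) := by
  rw [Complex.exp_eq_exp_iff_exists_int]
  exact ⟨-k, by push_cast; ring⟩

/-- Integration by parts: differentiation multiplies the k-th Fourier coefficient by `ik`. -/
theorem fourierCoef_of_hasDerivAt {f f' : ℝ → ℂ} (hf : ∀ x, HasDerivAt f (f' x) x)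
    (hf' : Continuous f') (hper : f π = f (-π)) (k : ℤ) :
    fourierCoef f' k = Complex.I * k * fourierCoef f k := by
  have hexp (x : ℝ) : HasDerivAt (fun x : ℝ => Complex.exp (-Complex.I * k * x))
      (Complex.exp (-Complex.I * k * x) * (-Complex.I * k)) x := by
    simpa using ((hasDerivAt_id x).ofReal_comp.const_mul (-Complex.I * (k : ℂ))).cexp
  have hparts := intervalIntegral.integral_deriv_mul_eq_sub (a := -π) (b := π)
    (fun x _ => hf x) (fun x _ => hexp x) (hf'.intervalIntegrable _ _)
    ((by fun_prop : Continuous fun x : ℝ =>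
      Complex.exp (-Complex.I * k * x) * (-Complex.I * k)).intervalIntegrable _ _)
  have hfc : Continuous f := continuous_iff_continuousAt.2 fun x => (hf x).continuousAt
  rw [hper, exp_neg_I_mul_int_mul_pi, sub_self, intervalIntegral.integral_add
    ((by fun_prop : Continuous fun x : ℝ =>
      f' x * Complex.exp (-Complex.I * k * x)).intervalIntegrable _ _)
    ((by fun_prop : Continuous fun x : ℝ =>
      f x * (Complex.exp (-Complex.I * k * x) * (-Complex.I * k))).intervalIntegrable _ _)] at hparts
  simp only [← mul_assoc, intervalIntegral.integral_mul_const] at hparts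
  unfold fourierCoef
  linear_combination (1 / (2 * (π : ℂ))) * hparts

theorem exists_norm_fourierCoef_le {f : ℝ → ℂ} (hf : Continuous f) :
    ∃ C, 0 ≤ C ∧ ∀ k, ‖fourierCoef f k‖ ≤ C := by
  obtain ⟨M, hM⟩ := isCompact_uIcc.exists_bound_of_continuousOn
    (hf.continuousOn (s := Set.uIcc (-π) π))
  have hM0 : 0 ≤ M := (norm_nonneg _).trans (hM π Set.right_mem_uIcc)
  refine ⟨‖1 / (2 * (π : ℂ))‖ * (M * |π - -π|), by positivity, fun k => ?_⟩
  rw [fourierCoef, norm_mul]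
  gcongr
  refine intervalIntegral.norm_integral_le_of_norm_le_const fun x hx => ?_
  rw [norm_mul, norm_exp_neg_I_mul_int_mul_ofReal, mul_one]
  exact hM x (Set.uIoc_subset_uIcc hx)

/-- The Fourier coefficients of a `C²` periodic function decay like `1 / k²`. -/
theorem exists_sq_mul_norm_fourierCoef_le {g : ℝ → ℝ} (hper : Function.Periodic g (2 * π))
    (hg : ContDiff ℝ 2 g) :
    ∃ C, 0 ≤ C ∧ ∀ k : ℤ, |(k : ℝ)| ^ 2 * ‖fourierCoef (fun t => (g t : ℂ)) k‖ ≤ C := by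
  have hg1 : ContDiff ℝ 1 (deriv g) := hg.deriv'
  have hg2 : Continuous (deriv (deriv g)) := hg1.continuous_deriv_one
  have hper' : Function.Periodic (deriv g) (2 * π) := fun x => by
    rw [← deriv_comp_add_const, hper.funext]
  have hends {h : ℝ → ℝ} (hh : Function.Periodic h (2 * π)) : h π = h (-π) := by
    rw [← hh (-π)]; congr 1; ring
  obtain ⟨C, hC0, hC⟩ := exists_norm_fourierCoef_le
    (f := fun t => ((deriv (deriv g) t : ℝ) : ℂ)) (by fun_prop)
  refine ⟨C, hC0, fun k => (le_of_eq ?_).trans (hC k)⟩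
  rw [fourierCoef_of_hasDerivAt (f := fun t => ((deriv g t : ℝ) : ℂ))
      (fun x => (hg1.differentiable one_ne_zero x).hasDerivAt.ofReal_comp) (by fun_prop)
      (by rw [hends hper']) k,
    fourierCoef_of_hasDerivAt (f := fun t => (g t : ℂ))
      (fun x => (hg.differentiable two_ne_zero x).hasDerivAt.ofReal_comp)
      (Complex.continuous_ofReal.comp hg1.continuous) (by rw [hends hper]) k]
  simp only [norm_mul, Complex.norm_I, Complex.norm_intCast]
  ring

theorem norm_concSum_le {f : ℝ → ℂ} {C : ℝ}
    (hf : ∀ k : ℤ, |(k : ℝ)| ^ 2 * ‖fourierCoef f k‖ ≤ C)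
    {σ : ℝ → ℝ} {K : NNReal} (hlip : LipschitzOnWith K σ (Set.Icc 0 1)) (hσ0 : σ 0 = 0)
    (hC : 0 ≤ C) (N : ℕ) (x : ℝ) :
    ‖concSum σ N f x‖ ≤
      C * K * (∑' k : ℤ, |(k : ℝ)| ^ (-(3 / 2) : ℝ)) * (N : ℝ) ^ (-(1 / 2) : ℝ) := by
  have hsum : Summable fun k : ℤ => |(k : ℝ)| ^ (-(3 / 2) : ℝ) :=
    Real.summable_abs_int_rpow (by norm_num)
  calc ‖concSum σ N f x‖
      ≤ ∑ k ∈ Finset.Icc (-(N : ℤ)) (N : ℤ) \ {0},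
          C * K * (N : ℝ) ^ (-(1 / 2) : ℝ) * |(k : ℝ)| ^ (-(3 / 2) : ℝ) := by
        rw [concSum, norm_mul, Complex.norm_I, one_mul]
        refine norm_sum_le_of_le _ fun k hk => ?_
        simp only [Finset.mem_sdiff, Finset.mem_Icc, Finset.mem_singleton] at hk
        obtain ⟨hkN, hk0⟩ := hk
        have hk : 0 < |(k : ℝ)| := by positivity
        have hle : |(k : ℝ)| ≤ N := by exact_mod_cast abs_le.2 hkN
        have hN : 0 < (N : ℝ) := hk.trans_le hle
        have hsign : ‖((Int.sign k : ℤ) : ℂ)‖ ≤ 1 := by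
          rw [Complex.norm_intCast]
          exact_mod_cast (Int.abs_sign_of_ne_zero hk0).le
        have hσ : |σ (|(k : ℝ)| / N)| ≤ K * (|(k : ℝ)| / N) := by
          have := hlip.dist_le_mul (|(k : ℝ)| / N) ⟨by positivity, (div_le_one hN).2 hle⟩ 0
            (by simp)
          simpa [Real.dist_eq, hσ0, abs_div] using this
        have hcoef : ‖fourierCoef f k‖ ≤ C / |(k : ℝ)| ^ 2 := by
          rw [le_div_iff₀ (by positivity), mul_comm]
          exact hf k
        have hpow : |(k : ℝ)|⁻¹ * (N : ℝ)⁻¹ ≤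
            (N : ℝ) ^ (-(1 / 2) : ℝ) * |(k : ℝ)| ^ (-(3 / 2) : ℝ) := by
          calc |(k : ℝ)|⁻¹ * (N : ℝ)⁻¹
              = |(k : ℝ)|⁻¹ * ((N : ℝ) ^ (-(1 / 2) : ℝ) * (N : ℝ) ^ (-(1 / 2) : ℝ)) := by
                rw [← Real.rpow_add hN, ← Real.rpow_neg_one (N : ℝ)]; norm_num
            _ ≤ |(k : ℝ)|⁻¹ * ((N : ℝ) ^ (-(1 / 2) : ℝ) * |(k : ℝ)| ^ (-(1 / 2) : ℝ)) := by
                have := Real.rpow_le_rpow_of_nonpos hk hle (by norm_num : (-(1 / 2) : ℝ) ≤ 0)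
                gcongr
            _ = (N : ℝ) ^ (-(1 / 2) : ℝ) * (|(k : ℝ)| ^ (-1 : ℝ) * |(k : ℝ)| ^ (-(1 / 2) : ℝ)) := by
                rw [Real.rpow_neg_one]; ring
            _ = _ := by rw [← Real.rpow_add hk]; norm_num
        rw [norm_mul, norm_mul, norm_mul, norm_exp_I_mul_int_mul_ofReal, mul_one,
          Complex.norm_real, Real.norm_eq_abs]
        calc ‖fourierCoef f k‖ * ‖((Int.sign k : ℤ) : ℂ)‖ * |σ (|(k : ℝ)| / N)|
            ≤ C / |(k : ℝ)| ^ 2 * 1 * (K * (|(k : ℝ)| / N)) := by gcongr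
          _ = C * K * (|(k : ℝ)|⁻¹ * (N : ℝ)⁻¹) := by field_simp
          _ ≤ C * K * ((N : ℝ) ^ (-(1 / 2) : ℝ) * |(k : ℝ)| ^ (-(3 / 2) : ℝ)) := by gcongr
          _ = _ := by ring
    _ ≤ C * K * (N : ℝ) ^ (-(1 / 2) : ℝ) * ∑' k : ℤ, |(k : ℝ)| ^ (-(3 / 2) : ℝ) := by
        rw [← Finset.mul_sum]
        gcongr
        exact hsum.sum_le_tsum _ fun _ _ => by positivity
    _ = _ := by ring

/-- For a 2π-periodic twice continuously differentiable `g` and a Lipschitz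
concentration factor `σ` on `[0,1]` with `σ(0) = 0`, the concentration factor sum of `g`
vanishes uniformly in `x` as `N → ∞`: `sup_x |S_N^σ[g](x)| → 0`. -/
theorem concSum_smooth_tendstoUniformly_zero (g : ℝ → ℝ)
    (hper : Function.Periodic g (2 * π)) (hg : ContDiff ℝ 2 g)
    (σ : ℝ → ℝ) (K : NNReal) (hlip : LipschitzOnWith K σ (Set.Icc 0 1)) (hσ0 : σ 0 = 0) :
    TendstoUniformly (fun (N : ℕ) (x : ℝ) => concSum σ N (fun t => (g t : ℂ)) x)
      (fun _ => 0) atTop := by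
  obtain ⟨C, hC0, hC⟩ := exists_sq_mul_norm_fourierCoef_le hper hg
  have hlim : Tendsto (fun N : ℕ => C * K * (∑' k : ℤ, |(k : ℝ)| ^ (-(3 / 2) : ℝ)) *
      (N : ℝ) ^ (-(1 / 2) : ℝ)) atTop (nhds 0) := by
    simpa using ((tendsto_rpow_neg_atTop (by norm_num : (0 : ℝ) < 1 / 2)).comp
      tendsto_natCast_atTop_atTop).const_mul (C * K * (∑' k : ℤ, |(k : ℝ)| ^ (-(3 / 2) : ℝ)))
  rw [Metric.tendstoUniformly_iff]
  intro ε hε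
  filter_upwards [hlim.eventually_lt_const hε] with N hN x
  rw [dist_zero_left]
  exact (norm_concSum_le hC hlip hσ0 hC0 N x).trans_lt hN
end
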